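/- arXiv:1608.05589 — 4 statements merged into one kernel-verified Lean document; each statement's English description precedes it below -/
import Mathlib

section
/- Let M and B be standard Borel spaces, μ a Borel probability measure on M, and π : M → B a Borel measurable map. Let T : M → M be a measurable bijection with measurable inverse satisfying T_*μ = μ, and let τ : B → B be a measurable bijection with measurable inverse satisfying π ∘ T = τ ∘ π. If (μ_b)_{b∈B} is a system of conditional measures for μ with respect to π, then the family b ↦ T_*(μ_{τ⁻¹(b)}) is also a system of conditional measures for μ with respect to π. -/
open MeasureTheory

/-- A system of conditional measures for `μ` with respect to `π`. -/
def IsCondSystem {M B : Type*} [MeasurableSpace M] [MeasurableSpace B]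
    (μ : Measure M) (π : M → B) (cond : B → Measure M) : Prop :=
  (∀ b, IsProbabilityMeasure (cond b)) ∧
  (∀ φ : M → ℝ, Measurable φ → (∃ C, ∀ x, |φ x| ≤ C) →
    Measurable (fun b => ∫ x, φ x ∂(cond b))) ∧
  (∀ᵐ b ∂(μ.map π), cond b (π ⁻¹' {b}) = 1) ∧
  (∀ φ : M → ℝ, Measurable φ → (∃ C, ∀ x, |φ x| ≤ C) →
    ∫ x, φ x ∂μ = ∫ b, (∫ x, φ x ∂(cond b)) ∂(μ.map π))

/-- If `T` is a measure-preserving measurable bijection of `(M, μ)` covering a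
measurable bijection `τ` of the base `B` (i.e. `π ∘ T = τ ∘ π`), and
`(cond b)_{b∈B}` is a system of conditional measures for `μ` with respect to `π`,
then `b ↦ T_*(cond (τ⁻¹ b))` is again a system of conditional measures for `μ`
with respect to `π`. -/
theorem pushforward_cond_system {M B : Type*}
    [MeasurableSpace M] [StandardBorelSpace M]
    [MeasurableSpace B] [StandardBorelSpace B]
    (μ : Measure M) [IsProbabilityMeasure μ] (π : M → B) (hπ : Measurable π)
    (T : M → M) (Tinv : M → M) (hT : Measurable T) (hTinv : Measurable Tinv)
    (hTleft : Function.LeftInverse Tinv T) (hTright : Function.RightInverse Tinv T)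
    (hTμ : μ.map T = μ)
    (τ : B → B) (τinv : B → B) (hτ : Measurable τ) (hτinv : Measurable τinv)
    (hτleft : Function.LeftInverse τinv τ) (hτright : Function.RightInverse τinv τ)
    (hcomm : π ∘ T = τ ∘ π)
    (cond : B → Measure M) (hcond : IsCondSystem μ π cond) :
    IsCondSystem μ π (fun b => (cond (τinv b)).map T) := by
  obtain ⟨h1, h2, h3, h4⟩ := hcond
  have hν : (μ.map π).map τ = μ.map π := by
    rw [Measure.map_map hτ hπ, ← hcomm, ← Measure.map_map hπ hT, hTμ]
  have hν' : (μ.map π).map τinv = μ.map π := by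
    conv_lhs => rw [← hν]
    rw [Measure.map_map hτinv hτ, hτleft.comp_eq_id, Measure.map_id]
  have hint : ∀ φ : M → ℝ, Measurable φ → ∀ b,
      ∫ x, φ x ∂((cond (τinv b)).map T) = ∫ x, φ (T x) ∂(cond (τinv b)) := fun φ hφ b =>
    integral_map hT.aemeasurable hφ.aestronglyMeasurable
  refine ⟨fun b => ?_, fun φ hφ hb => ?_, ?_, fun φ hφ hb => ?_⟩
  · have := h1 (τinv b)
    exact Measure.isProbabilityMeasure_map hT.aemeasurable
  · obtain ⟨C, hC⟩ := hb
    simp only [hint φ hφ]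
    exact (h2 (fun x => φ (T x)) (hφ.comp hT) ⟨C, fun x => hC _⟩).comp hτinv
  · have h5 : ∀ᵐ b ∂(μ.map π), cond (τinv b) (π ⁻¹' {τinv b}) = 1 := by
      have h6 := h3
      rw [← hν'] at h6
      exact ae_of_ae_map hτinv.aemeasurable h6
    filter_upwards [h5] with b hb
    rw [Measure.map_apply hT (hπ (measurableSet_singleton b)), ← hb]
    congr 1
    ext x
    have hx : π (T x) = τ (π x) := congrFun hcomm x
    simp only [Set.mem_preimage, Set.mem_singleton_iff, hx]
    constructor
    · intro h
      rw [← h, hτleft]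
    · intro h
      rw [h, hτright]
  · obtain ⟨C, hC⟩ := hb
    have hm := h2 (fun x => φ (T x)) (hφ.comp hT) ⟨C, fun x => hC _⟩
    have h7 := h4 (fun x => φ (T x)) (hφ.comp hT) ⟨C, fun x => hC _⟩
    simp only [hint φ hφ]
    rw [← integral_map (f := fun b => ∫ x, φ (T x) ∂(cond b)) hτinv.aemeasurable
      hm.aestronglyMeasurable, hν', ← h7,
      ← integral_map hT.aemeasurable hφ.aestronglyMeasurable, hTμ]
end

section
/- Let M and B be standard Borel spaces, let m be a finite Borel measure on M, let π : M → B be a Borel measurable map, and let A ⊆ A' be measurable subsets of M. Set μ = π_*(m|_A) and μ' = π_*(m|_{A'}), and let (m_b)_{b∈B} be a disintegration of m|_A over the base measure μ and (m'_b)_{b∈B} a disintegration of m|_{A'} over the base measure μ' (both with respect to π). Then μ is absolutely continuous with respect to μ', and for μ'-almost every b ∈ B, the restricted measure (m'_b)|_A equals (dμ/dμ')(b) · m_b. -/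
open MeasureTheory

/-- A disintegration of the finite measure `ν` over the base measure `η`, with
respect to the map `π : M → B` : a family `(cond b)_{b∈B}` of probability
measures on `M` such that (i) `b ↦ cond b E` is measurable for every measurable
`E`, (ii) `cond b` is concentrated on the fiber `π⁻¹ {b}` for `η`-a.e. `b`, and
(iii) `ν E = ∫ cond b E dη(b)` for every measurable `E`. -/
def IsDisintegration {M B : Type*} [MeasurableSpace M] [MeasurableSpace B]
    (ν : Measure M) (π : M → B) (η : Measure B) (cond : B → Measure M) : Prop :=
  (∀ b, IsProbabilityMeasure (cond b)) ∧
  (∀ E : Set M, MeasurableSet E → Measurable (fun b => cond b E)) ∧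
  (∀ᵐ b ∂η, cond b (π ⁻¹' {b}) = 1) ∧
  (∀ E : Set M, MeasurableSet E → ν E = ∫⁻ b, cond b E ∂η)

theorem IsDisintegration.setLIntegral_aux {M B : Type*} [MeasurableSpace M] [MeasurableSpace B]
    [MeasurableSingletonClass B]
    {ν : Measure M} {π : M → B} {η : Measure B} {cond : B → Measure M}
    (hπ : Measurable π) (h : IsDisintegration ν π η cond) {S : Set B} (hS : MeasurableSet S)
    {E : Set M} (hE : MeasurableSet E) :
    ∫⁻ b in S, cond b E ∂η = ν (E ∩ π ⁻¹' S) := by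
  obtain ⟨h1, h2, h3, h4⟩ := h
  rw [h4 _ (hE.inter (hπ hS)), ← lintegral_indicator hS]
  apply lintegral_congr_ae
  filter_upwards [h3] with b hb
  have := h1 b
  have hae : ∀ᵐ x ∂(cond b), x ∈ π ⁻¹' {b} :=
    (prob_compl_eq_zero_iff (hπ (measurableSet_singleton b))).2 hb
  by_cases hbS : b ∈ S
  · rw [Set.indicator_of_mem hbS]
    apply measure_congr
    filter_upwards [hae] with x hx
    have hx : π x = b := hx
    apply propext
    change x ∈ E ↔ x ∈ E ∧ π x ∈ S
    simp [hx, hbS]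
  · rw [Set.indicator_of_notMem hbS]
    symm
    rw [measure_eq_zero_iff_ae_notMem]
    filter_upwards [hae] with x hx
    have hx : π x = b := hx
    rintro ⟨-, hxS⟩
    exact hbS (hx ▸ hxS)

/-- Relation between the conditional measures of a measure restricted to two
nested sets `A ⊆ A'` (Lemma 3.2 of Avila–Viana–Wilkinson, Equation (3) of the
paper): with `μ = π_*(m|_A)` and `μ' = π_*(m|_{A'})`, one has `μ ≪ μ'` and, for
`μ'`-a.e. `b`, the restriction of the conditional measure `m'_b` to `A` equals
`(dμ/dμ')(b) · m_b`. -/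
theorem restrict_disintegration_nested {M B : Type*}
    [MeasurableSpace M] [StandardBorelSpace M]
    [MeasurableSpace B] [StandardBorelSpace B]
    (m : Measure M) [IsFiniteMeasure m] (π : M → B) (hπ : Measurable π)
    (A A' : Set M) (hA : MeasurableSet A) (hA' : MeasurableSet A') (hAA' : A ⊆ A')
    (μ μ' : Measure B) (hμ : μ = (m.restrict A).map π) (hμ' : μ' = (m.restrict A').map π)
    (cond cond' : B → Measure M)
    (hcond : IsDisintegration (m.restrict A) π μ cond)
    (hcond' : IsDisintegration (m.restrict A') π μ' cond') :
    μ ≪ μ' ∧ ∀ᵐ b ∂μ', (cond' b).restrict A = (μ.rnDeriv μ' b) • cond b := by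
  have hfin : IsFiniteMeasure μ := by rw [hμ]; infer_instance
  have hfin' : IsFiniteMeasure μ' := by rw [hμ']; infer_instance
  have hac : μ ≪ μ' := by
    rw [hμ, hμ']
    exact (Measure.absolutelyContinuous_of_le (Measure.restrict_mono hAA' le_rfl)).map hπ
  refine ⟨hac, ?_⟩
  have key : ∀ E : Set M, MeasurableSet E →
      ∀ᵐ b ∂μ', cond' b (E ∩ A) = μ.rnDeriv μ' b * cond b E := by
    intro E hE
    refine ae_eq_of_forall_setLIntegral_eq_of_sigmaFinite (hcond'.2.1 _ (hE.inter hA))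
      ((Measure.measurable_rnDeriv μ μ').mul (hcond.2.1 E hE)) ?_
    intro S hS _
    rw [hcond'.setLIntegral_aux hπ hS (hE.inter hA),
      setLIntegral_rnDeriv_mul hac (hcond.2.1 E hE).aemeasurable hS,
      hcond.setLIntegral_aux hπ hS hE,
      Measure.restrict_apply ((hE.inter hA).inter (hπ hS)),
      Measure.restrict_apply (hE.inter (hπ hS))]
    congr 1
    ext x
    have := @hAA' x
    simp only [Set.mem_inter_iff]
    tauto
  let C := MeasurableSpace.countableGeneratingSet M
  have hCm : ∀ E ∈ generateSetAlgebra C, MeasurableSet E := by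
    intro E hE
    have := MeasurableSpace.measurableSet_generateFrom hE
    rwa [generateFrom_generateSetAlgebra_eq,
      MeasurableSpace.generateFrom_countableGeneratingSet] at this
  have hcount : (generateSetAlgebra C).Countable :=
    countable_generateSetAlgebra MeasurableSpace.countable_countableGeneratingSet
  have hall := (ae_ball_iff hcount).2 (fun E hE => key E (hCm E hE))
  filter_upwards [hall, key Set.univ MeasurableSet.univ] with b hb hu
  have := hcond'.1 b
  refine ext_of_generate_finite (generateSetAlgebra C) ?_
    (isSetAlgebra_generateSetAlgebra.isSetRing.isSetSemiring.isPiSystem) ?_ ?_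
  · rw [generateFrom_generateSetAlgebra_eq,
      MeasurableSpace.generateFrom_countableGeneratingSet]
  · intro E hE
    rw [Measure.restrict_apply (hCm E hE), hb E hE]
    simp
  · rw [Measure.restrict_apply MeasurableSet.univ, hu]
    simp
end

section
/- Let M and B be standard Borel spaces, let m be a finite Borel measure on M, let π : M → B be a Borel measurable map, and let A ⊆ A' be measurable subsets of M. Set μ = π_*(m|_A) and μ' = π_*(m|_{A'}), let (m_b)_{b∈B} be a disintegration of m|_A over μ and (m'_b)_{b∈B} a disintegration of m|_{A'} over μ' (both with respect to π). Let b ↦ λ_b be a measurable kernel of σ-finite measures on M such that for μ'-almost every b, 0 < λ_b(A ∩ π⁻¹{b}) < ∞ and 0 < λ_b(A' ∩ π⁻¹{b}) < ∞. Let K ≥ 1 and suppose: for μ-almost every b, m_b has a density ρ_b with respect to the normalized measure λ_b|_{A∩π⁻¹{b}} / λ_b(A∩π⁻¹{b}) satisfying K⁻¹ ≤ ρ_b ≤ K, and for μ'-almost every b, m'_b has a density ρ'_b with respect to λ_b|_{A'∩π⁻¹{b}} / λ_b(A'∩π⁻¹{b}) satisfying K⁻¹ ≤ ρ'_b ≤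 K. Then μ and μ' are mutually absolutely continuous and for μ'-almost every b, K⁻² R(b) ≤ (dμ'/dμ)(b) ≤ K² R(b), where R(b) = λ_b(A'∩π⁻¹{b}) / λ_b(A∩π⁻¹{b}). -/
open MeasureTheory ENNReal

/-- The UBD-type estimate of the paper: if the conditional measures of `m`
restricted to the nested sets `A ⊆ A'` have densities pinched in `[K⁻¹, K]` with
respect to the normalized reference fiber measures `λ_b`, then the projected base
measures `μ = π_*(m|_A)` and `μ' = π_*(m|_{A'})` are mutually absolutely
continuous, with `dμ'/dμ` comparable, up to the factor `K²`, to the ratio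
`R(b) = λ_b(A' ∩ π⁻¹{b}) / λ_b(A ∩ π⁻¹{b})`. -/
theorem rnDeriv_comparable_of_UBD {M B : Type*}
    [MeasurableSpace M] [StandardBorelSpace M]
    [MeasurableSpace B] [StandardBorelSpace B]
    (m : Measure M) [IsFiniteMeasure m] (π : M → B) (hπ : Measurable π)
    (A A' : Set M) (hA : MeasurableSet A) (hA' : MeasurableSet A') (hAA' : A ⊆ A')
    (μ μ' : Measure B) (hμ : μ = (m.restrict A).map π) (hμ' : μ' = (m.restrict A').map π)
    (cond cond' : B → Measure M)
    (hcond : IsDisintegration (m.restrict A) π μ cond)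
    (hcond' : IsDisintegration (m.restrict A') π μ' cond')
    (lam : B → Measure M) (hlam_meas : ∀ E : Set M, MeasurableSet E →
      Measurable (fun b => lam b E)) (hlam_sf : ∀ b, SigmaFinite (lam b))
    (hlam_pos : ∀ᵐ b ∂μ', (0 < lam b (A ∩ π ⁻¹' {b}) ∧ lam b (A ∩ π ⁻¹' {b}) < ⊤) ∧
      (0 < lam b (A' ∩ π ⁻¹' {b}) ∧ lam b (A' ∩ π ⁻¹' {b}) < ⊤))
    (K : ℝ) (hK : 1 ≤ K)
    (hdens : ∀ᵐ b ∂μ, ∃ ρ : M → ℝ≥0∞,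
      cond b = ((lam b (A ∩ π ⁻¹' {b}))⁻¹ •
        (lam b).restrict (A ∩ π ⁻¹' {b})).withDensity ρ ∧
      ∀ᵐ x ∂((lam b).restrict (A ∩ π ⁻¹' {b})),
        ENNReal.ofReal K⁻¹ ≤ ρ x ∧ ρ x ≤ ENNReal.ofReal K)
    (hdens' : ∀ᵐ b ∂μ', ∃ ρ' : M → ℝ≥0∞,
      cond' b = ((lam b (A' ∩ π ⁻¹' {b}))⁻¹ •
        (lam b).restrict (A' ∩ π ⁻¹' {b})).withDensity ρ' ∧
      ∀ᵐ x ∂((lam b).restrict (A' ∩ π ⁻¹' {b})),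
        ENNReal.ofReal K⁻¹ ≤ ρ' x ∧ ρ' x ≤ ENNReal.ofReal K) :
    (μ ≪ μ' ∧ μ' ≪ μ) ∧
    ∀ᵐ b ∂μ', ENNReal.ofReal (K ^ 2)⁻¹ *
        (lam b (A' ∩ π ⁻¹' {b}) / lam b (A ∩ π ⁻¹' {b})) ≤ μ'.rnDeriv μ b ∧
      μ'.rnDeriv μ b ≤ ENNReal.ofReal (K ^ 2) *
        (lam b (A' ∩ π ⁻¹' {b}) / lam b (A ∩ π ⁻¹' {b})) := by
  classical
  obtain ⟨hprob, hmeas, hfib, hint⟩ := hcond'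
  have hfin' : IsFiniteMeasure μ' := by rw [hμ']; infer_instance
  have hfin : IsFiniteMeasure μ := by rw [hμ]; infer_instance
  have hgm : Measurable (fun b => cond' b A) := hmeas A hA
  have hμg : μ = μ'.withDensity (fun b => cond' b A) := by
    ext E hE
    rw [withDensity_apply _ hE, hμ, Measure.map_apply hπ hE,
      Measure.restrict_apply (hπ hE)]
    have h1 : m (π ⁻¹' E ∩ A) = m.restrict A' (π ⁻¹' E ∩ A) := by
      rw [Measure.restrict_apply ((hπ hE).inter hA), Set.inter_assoc,
        Set.inter_eq_left.mpr hAA']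
    rw [h1, hint _ ((hπ hE).inter hA), ← lintegral_indicator hE]
    apply lintegral_congr_ae
    filter_upwards [hfib] with b hb
    have := hprob b
    have hb0 : cond' b (π ⁻¹' {b})ᶜ = 0 :=
      (prob_compl_eq_zero_iff (hπ (measurableSet_singleton b))).mpr hb
    by_cases hbE : b ∈ E
    · rw [Set.indicator_of_mem hbE]
      apply le_antisymm (measure_mono Set.inter_subset_right)
      rw [← measure_inter_add_diff A (hπ hE)]
      have : cond' b (A \ π ⁻¹' E) = 0 := by
        refine measure_mono_null ?_ hb0
        rintro x ⟨_, hx⟩ hxb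
        apply hx
        have : π x = b := hxb
        simpa [this] using hbE
      rw [this, add_zero, Set.inter_comm]
    · rw [Set.indicator_of_notMem hbE]
      refine measure_mono_null ?_ hb0
      rintro x ⟨hx, _⟩ hxb
      have : π x = b := hxb
      exact hbE (this ▸ hx)
  have hK0 : 0 < K := by linarith
  have key : ∀ᵐ b ∂μ', cond' b A ≠ 0 ∧ ENNReal.ofReal K⁻¹ *
        (lam b (A' ∩ π ⁻¹' {b}) / lam b (A ∩ π ⁻¹' {b})) ≤ (cond' b A)⁻¹ ∧
      (cond' b A)⁻¹ ≤ ENNReal.ofReal K *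
        (lam b (A' ∩ π ⁻¹' {b}) / lam b (A ∩ π ⁻¹' {b})) := by
    filter_upwards [hlam_pos, hdens'] with b ⟨⟨ha0, ha1⟩, ⟨hb0, hb1⟩⟩ ⟨ρ, hρ, hbd⟩
    have hS : A ∩ (A' ∩ π ⁻¹' {b}) = A ∩ π ⁻¹' {b} := by
      rw [← Set.inter_assoc, Set.inter_eq_left.mpr hAA']
    have hform : cond' b A = (lam b (A' ∩ π ⁻¹' {b}))⁻¹ *
        ∫⁻ x in A ∩ π ⁻¹' {b}, ρ x ∂(lam b) := by
      rw [hρ, withDensity_apply _ hA, Measure.restrict_smul, lintegral_smul_measure,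
        Measure.restrict_restrict hA, hS, smul_eq_mul]
    have hbd' := ae_restrict_of_ae_restrict_of_subset
      (Set.inter_subset_inter_left (π ⁻¹' {b}) hAA') hbd
    have hlo : ENNReal.ofReal K⁻¹ * lam b (A ∩ π ⁻¹' {b}) ≤
        ∫⁻ x in A ∩ π ⁻¹' {b}, ρ x ∂(lam b) := by
      rw [← setLIntegral_const]
      exact lintegral_mono_ae (hbd'.mono fun x hx => hx.1)
    have hhi : ∫⁻ x in A ∩ π ⁻¹' {b}, ρ x ∂(lam b) ≤
        ENNReal.ofReal K * lam b (A ∩ π ⁻¹' {b}) := by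
      rw [← setLIntegral_const]
      exact lintegral_mono_ae (hbd'.mono fun x hx => hx.2)
    have hk0 : ENNReal.ofReal K ≠ 0 := by simpa using hK0
    have hkt : ENNReal.ofReal K ≠ ⊤ := ENNReal.ofReal_ne_top
    rw [ENNReal.ofReal_inv_of_pos hK0] at hlo ⊢
    generalize lam b (A ∩ π ⁻¹' {b}) = a at *
    generalize lam b (A' ∩ π ⁻¹' {b}) = c at *
    generalize ENNReal.ofReal K = k at *
    generalize ∫⁻ x in A ∩ π ⁻¹' {b}, ρ x ∂(lam b) = J at *
    rw [hform]
    have hJ0 : J ≠ 0 := by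
      intro h
      rw [h] at hlo
      simp [ha0.ne', hkt] at hlo
    have hinv : (c⁻¹ * J)⁻¹ = c * J⁻¹ := by
      rw [ENNReal.mul_inv (Or.inr ?_) (Or.inr hJ0), inv_inv]
      exact ne_top_of_le_ne_top (ENNReal.mul_ne_top hkt ha1.ne) hhi
    refine ⟨mul_ne_zero (ENNReal.inv_ne_zero.mpr hb1.ne) hJ0, ?_, ?_⟩
    · rw [hinv, div_eq_mul_inv, mul_left_comm]
      gcongr
      rw [← ENNReal.mul_inv (Or.inl hk0) (Or.inl hkt)]
      exact ENNReal.inv_le_inv.mpr hhi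
    · rw [hinv, div_eq_mul_inv, mul_left_comm]
      gcongr
      have := ENNReal.inv_le_inv.mpr hlo
      rwa [ENNReal.mul_inv (Or.inr ha1.ne) (Or.inr ha0.ne'), inv_inv] at this
  have hne0 : ∀ᵐ b ∂μ', cond' b A ≠ 0 := key.mono fun b hb => hb.1
  have hnet : ∀ᵐ b ∂μ', cond' b A ≠ ⊤ :=
    Filter.Eventually.of_forall fun b => by have := hprob b; exact measure_ne_top _ _
  have hinv : μ.withDensity (fun b => (cond' b A)⁻¹) = μ' := by
    rw [hμg]
    exact withDensity_inv_same₀ hgm.aemeasurable hne0 hnet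
  have hac : μ ≪ μ' := by rw [hμg]; exact withDensity_absolutelyContinuous _ _
  have hac' : μ' ≪ μ := by rw [← hinv]; exact withDensity_absolutelyContinuous _ _
  refine ⟨⟨hac, hac'⟩, ?_⟩
  have hrn : μ'.rnDeriv μ =ᵐ[μ] fun b => (cond' b A)⁻¹ := by
    have := Measure.rnDeriv_withDensity μ hgm.inv
    have h2 : μ.withDensity (fun b => cond' b A)⁻¹ = μ' := hinv
    rw [h2] at this
    exact this
  filter_upwards [key, hac'.ae_le hrn] with b ⟨_, h1, h2⟩ hb
  have hKK : K ≤ K ^ 2 := by nlinarith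
  rw [hb]
  refine ⟨le_trans ?_ h1, h2.trans ?_⟩
  · gcongr
  · gcongr
end

section
/- Let M be a compact topological space, let f : M → M be continuous, let ψ : M → ℝ be continuous, and let L ∈ ℝ. Assume that for every x ∈ M the Birkhoff averages converge: (1/n) · Σ_{i=0}^{n-1} ψ(f^i(x)) → L as n → ∞. Then for every ε > 0 there exists a constant C ∈ ℝ such that Σ_{i=0}^{n-1} ψ(f^i(x)) ≥ n·(L − ε) − C for every x ∈ M and every natural number n. Equivalently, in multiplicative form, there exists C' > 0 with Π_{i=0}^{n-1} e^{ψ(f^i(x))} ≥ C' · e^{n(L−ε)} for all x and n. -/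
open Filter

/-- If the Birkhoff averages of a continuous function `ψ` over a continuous map
`f` of a compact space converge at every point to the same limit `L`, then for
every `ε > 0` the Birkhoff sums satisfy the uniform lower bound
`Σ_{i<n} ψ(f^i x) ≥ n(L − ε) − C`; equivalently, in multiplicative form,
`Π_{i<n} e^{ψ(f^i x)} ≥ C' e^{n(L−ε)}` for some `C' > 0`. -/
theorem birkhoff_uniform_lower_bound {M : Type*} [TopologicalSpace M] [CompactSpace M]
    (f : M → M) (hf : Continuous f) (ψ : M → ℝ) (hψ : Continuous ψ) (L : ℝ)
    (hbirkhoff : ∀ x : M, Tendsto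
      (fun n : ℕ => (1 / (n : ℝ)) * ∑ i ∈ Finset.range n, ψ (f^[i] x))
      atTop (nhds L)) :
    ∀ ε > (0 : ℝ),
      (∃ C : ℝ, ∀ (x : M) (n : ℕ),
        (∑ i ∈ Finset.range n, ψ (f^[i] x)) ≥ n * (L - ε) - C) ∧
      (∃ C' > (0 : ℝ), ∀ (x : M) (n : ℕ),
        (∏ i ∈ Finset.range n, Real.exp (ψ (f^[i] x))) ≥
          C' * Real.exp (n * (L - ε))) := by
  intro ε hε
  have key : ∃ C : ℝ, ∀ (x : M) (n : ℕ),
      (∑ i ∈ Finset.range n, ψ (f^[i] x)) ≥ n * (L - ε) - C := by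
    have hS : ∀ n : ℕ, Continuous fun x => ∑ i ∈ Finset.range n, ψ (f^[i] x) := fun n =>
      continuous_finsetSum _ fun i _ => hψ.comp (hf.iterate i)
    obtain ⟨t, ht⟩ := isCompact_univ.elim_finite_subcover
      (fun n : ℕ => {x : M | ((n + 1 : ℕ) : ℝ) * (L - ε) < ∑ i ∈ Finset.range (n + 1), ψ (f^[i] x)})
      (fun n => isOpen_lt continuous_const (hS (n + 1)))
      (by
        intro x _
        have h1 := (hbirkhoff x).eventually (lt_mem_nhds (show L - ε < L by linarith))
        obtain ⟨n, hn, hn1⟩ := (h1.and (eventually_ge_atTop 1)).exists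
        obtain ⟨m, rfl⟩ : ∃ m, n = m + 1 := ⟨n - 1, by omega⟩
        refine Set.mem_iUnion.2 ⟨m, ?_⟩
        have hp : (0 : ℝ) < ((m + 1 : ℕ) : ℝ) := by positivity
        have h2 := mul_lt_mul_of_pos_left hn hp
        rw [← mul_assoc, mul_one_div_cancel hp.ne', one_mul] at h2
        exact h2)
    obtain ⟨B, hB⟩ := isCompact_univ.exists_bound_of_continuousOn
      (f := fun x => ψ x - (L - ε)) (hψ.sub continuous_const).continuousOn
    set N := t.sup id + 1 with hN
    refine ⟨N * |B|, fun x n => ?_⟩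
    induction n using Nat.strong_induction_on generalizing x with
    | _ n ih =>
      by_cases hnN : n ≤ N
      · have h3 : ∑ i ∈ Finset.range n, ((L - ε) - |B|) ≤ ∑ i ∈ Finset.range n, ψ (f^[i] x) := by
          refine Finset.sum_le_sum fun i _ => ?_
          have h4 := hB (f^[i] x) (Set.mem_univ _)
          rw [Real.norm_eq_abs] at h4
          have h5 := (abs_le.1 (h4.trans (le_abs_self B))).1
          linarith
        rw [Finset.sum_const, Finset.card_range, nsmul_eq_mul] at h3
        have h6 : (n : ℝ) * |B| ≤ N * |B| := by gcongr
        linarith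
      · have hx := ht (Set.mem_univ x)
        simp only [Set.mem_iUnion] at hx
        obtain ⟨m, hm, hxm⟩ := hx
        have hmN : m ≤ t.sup id := Finset.le_sup (f := id) hm
        obtain ⟨k, rfl⟩ : ∃ k, n = (m + 1) + k := ⟨n - (m + 1), by omega⟩
        have h7 := ih k (by omega) (f^[m + 1] x)
        rw [Finset.sum_range_add]
        have h8 : ∀ i, f^[m + 1 + i] x = f^[i] (f^[m + 1] x) := fun i => by
          rw [add_comm (m + 1) i, Function.iterate_add_apply]
        simp only [h8]
        have h9 : ((m + 1 : ℕ) : ℝ) * (L - ε) < ∑ i ∈ Finset.range (m + 1), ψ (f^[i] x) := hxm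
        rw [Nat.cast_add (m + 1) k]
        linarith
  refine ⟨key, ?_⟩
  obtain ⟨C, hC⟩ := key
  refine ⟨Real.exp (-C), Real.exp_pos _, fun x n => ?_⟩
  rw [← Real.exp_sum, ← Real.exp_add]
  apply Real.exp_le_exp.2
  linarith [hC x n]
end
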